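/- Let K be the field of rational functions over ℂ in the 15 coordinates of a triple (u₁, u₂, C), equipped with the action of G = SO₃(ℂ)×SO₃(ℂ) by field automorphisms induced by precomposition with the linear action (u₁,u₂,C) ↦ (g₁u₁, g₂u₂, g₁Cg₂ᵀ). Then the nine invariants f₁, …, f₉ are algebraically independent over ℂ and the fixed field K^G equals the subfield ℂ(f₁, …, f₉) generated over ℂ by f₁, …, f₉. -/

import Mathlib

open Matrix MvPolynomial

/-- `SO₃(ℂ)`: complex 3×3 matrices with `gᵀ g = 1` and `det g = 1`. -/
def SO3 (g : Matrix (Fin 3) (Fin 3) ℂ) : Prop := gᵀ * g = 1 ∧ g.det = 1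

/-- The generic vector `u₁` with polynomial entries. -/
noncomputable def genU₁ : Fin 3 → MvPolynomial (Fin 15) ℂ := ![X 0, X 1, X 2]

/-- The generic vector `u₂` with polynomial entries. -/
noncomputable def genU₂ : Fin 3 → MvPolynomial (Fin 15) ℂ := ![X 3, X 4, X 5]

/-- The generic 3×3 matrix `C = (cᵢⱼ)` with polynomial entries. -/
noncomputable def genC : Matrix (Fin 3) (Fin 3) (MvPolynomial (Fin 15) ℂ) :=
  !![X 6, X 7, X 8; X 9, X 10, X 11; X 12, X 13, X 14]

/-- The nine invariants `f₁, …, f₉` as polynomials in the 15 coordinates of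
`(u₁, u₂, C)`, where `v₁ = u₁ × (Cu₂)`, `v₂ = u₂ × (Cᵀu₁)`, `w₁ = u₁ × v₁`,
`w₂ = u₂ × v₂`. -/
noncomputable def genFpoly : Fin 9 → MvPolynomial (Fin 15) ℂ :=
  let u₁ := genU₁
  let u₂ := genU₂
  let C := genC
  let v₁ := crossProduct u₁ (C *ᵥ u₂)
  let v₂ := crossProduct u₂ (Cᵀ *ᵥ u₁)
  let w₁ := crossProduct u₁ v₁
  let w₂ := crossProduct u₂ v₂
  ![u₁ ⬝ᵥ u₁, u₂ ⬝ᵥ u₂, v₁ ⬝ᵥ v₁, v₂ ⬝ᵥ v₂, u₁ ⬝ᵥ (C *ᵥ u₂),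
    v₁ ⬝ᵥ (C *ᵥ v₂), w₁ ⬝ᵥ (C *ᵥ w₂), v₁ ⬝ᵥ (C *ᵥ w₂), w₁ ⬝ᵥ (C *ᵥ v₂)]

/-- The SO₃(ℂ)×SO₃(ℂ)-action on the 15 coordinates of a triple `(u₁, u₂, C)`,
given by `(u₁, u₂, C) ↦ (g₁u₁, g₂u₂, g₁Cg₂ᵀ)`. -/
noncomputable def genAct (g₁ g₂ : Matrix (Fin 3) (Fin 3) ℂ) (x : Fin 15 → ℂ) :
    Fin 15 → ℂ :=
  let u₁ : Fin 3 → ℂ := ![x 0, x 1, x 2]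
  let u₂ : Fin 3 → ℂ := ![x 3, x 4, x 5]
  let C : Matrix (Fin 3) (Fin 3) ℂ :=
    !![x 6, x 7, x 8; x 9, x 10, x 11; x 12, x 13, x 14]
  let u₁' := g₁ *ᵥ u₁
  let u₂' := g₂ *ᵥ u₂
  let C' := g₁ * C * g₂ᵀ
  ![u₁' 0, u₁' 1, u₁' 2, u₂' 0, u₂' 1, u₂' 2,
    C' 0 0, C' 0 1, C' 0 2, C' 1 0, C' 1 1, C' 1 2, C' 2 0, C' 2 1, C' 2 2]

section SignChange

variable {σ : Type*}

/-- Rescaling of the variables of a polynomial by constants. -/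
noncomputable def scaleVars (ε : σ → ℂ) : MvPolynomial σ ℂ →ₐ[ℂ] MvPolynomial σ ℂ :=
  aeval fun i => C (ε i) * X i

lemma eval_scaleVars (ε t : σ → ℂ) (p : MvPolynomial σ ℂ) :
    eval t (scaleVars ε p) = eval (ε * t) p := by
  induction p using MvPolynomial.induction_on with
  | C a => simp [scaleVars]
  | add p q hp hq => simp [hp, hq]
  | mul_X p i hp => simp [hp]; simp [scaleVars]

lemma scaleVars_scaleVars (ε ε' : σ → ℂ) (p : MvPolynomial σ ℂ) :
    scaleVars ε (scaleVars ε' p) = scaleVars (ε * ε') p := by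
  induction p using MvPolynomial.induction_on with
  | C a => simp [scaleVars]
  | add p q hp hq => simp [hp, hq]
  | mul_X p i hp =>
    have h : scaleVars ε (scaleVars ε' (X i)) = scaleVars (ε * ε') (X i) := by
      simp [scaleVars]
      ring
    simp only [map_mul, hp, h]

lemma scaleVars_one (p : MvPolynomial σ ℂ) : scaleVars 1 p = p := by
  induction p using MvPolynomial.induction_on with
  | C a => simp [scaleVars]
  | add p q hp hq => simp [hp, hq]
  | mul_X p i hp => simp only [map_mul, hp]; simp [scaleVars]

variable [DecidableEq σ] (S : Finset σ)

/-- The variables of a polynomial, those in `S` being squared. -/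
noncomputable def squareVars : σ → MvPolynomial σ ℂ := fun i => if i ∈ S then X i ^ 2 else X i

/-- The sign vector of `γ`, restricted to the variables in `S`. -/
def signVec (γ : σ → ℤˣ) : σ → ℂ := fun i => if i ∈ S then ((γ i : ℤ) : ℂ) else 1

lemma signVec_mul (γ γ' : σ → ℤˣ) : signVec S (γ * γ') = signVec S γ * signVec S γ' := by
  ext i
  by_cases h : i ∈ S <;> simp [signVec, h]

lemma signVec_one : signVec S 1 = 1 := by
  ext i
  simp [signVec]

variable [Fintype σ]

lemma coeff_scaleVars (ε : σ → ℂ) (p : MvPolynomial σ ℂ) (m : σ →₀ ℕ) :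
    coeff m (scaleVars ε p) = (∏ i, ε i ^ m i) * coeff m p := by
  induction p using MvPolynomial.induction_on' with
  | add p q hp hq => simp [hp, hq, mul_add]
  | monomial k c =>
    have h : scaleVars ε (monomial k c) = monomial k ((∏ i, ε i ^ k i) * c) := by
      rw [scaleVars, aeval_monomial, Finsupp.prod_fintype _ _ (by simp)]
      simp only [mul_pow, Finset.prod_mul_distrib, ← map_pow, ← map_prod]
      rw [monomial_eq (s := k), Finsupp.prod_fintype _ _ (by simp), C_mul]
      simp only [algebraMap_eq]
      ring
    rw [h, coeff_monomial, coeff_monomial]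
    split_ifs with hk
    · rw [hk]
    · simp

lemma exists_aeval_squareVars_eq {p : MvPolynomial σ ℂ}
    (hp : ∀ γ : σ → ℤˣ, scaleVars (signVec S γ) p = p) :
    ∃ N : MvPolynomial σ ℂ, aeval (squareVars S) N = p := by
  change p ∈ (aeval (squareVars S) : MvPolynomial σ ℂ →ₐ[ℂ] MvPolynomial σ ℂ).range
  rw [p.as_sum]
  refine sum_mem fun m hm => ?_
  rw [monomial_eq, Finsupp.prod_fintype _ _ (by simp)]
  refine mul_mem ⟨C (coeff m p), by simp⟩ (prod_mem fun i _ => ?_)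
  by_cases hi : i ∈ S
  · have h := congrArg (coeff m) (hp (Pi.mulSingle i (-1)))
    rw [coeff_scaleVars, Finset.prod_eq_single i] at h
    · have h1 : (-1 : ℂ) ^ m i = 1 := by
        have := mem_support_iff.1 hm
        simpa [signVec, hi, this] using h
      have h2 : Even (m i) := by
        by_contra h3
        rw [Nat.not_even_iff_odd] at h3
        rw [h3.neg_one_pow] at h1
        norm_num at h1
      obtain ⟨k, hk⟩ := h2
      refine ⟨X i ^ k, ?_⟩
      simp [squareVars, hi, hk, ← pow_mul, two_mul]
    · intro j _ hj
      simp [signVec, Pi.mulSingle_eq_of_ne hj]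
    · simp
  · exact ⟨X i ^ m i, by simp [squareVars, hi]⟩

/-- A fraction invariant under the sign changes of the variables in `S` is a fraction in the
squares of these variables and the other variables. -/
lemma exists_squareVars_fraction {n d : MvPolynomial σ ℂ} (hd : d ≠ 0)
    (h : ∀ γ : σ → ℤˣ, n * scaleVars (signVec S γ) d = scaleVars (signVec S γ) n * d) :
    ∃ N D r : MvPolynomial σ ℂ, d * r ≠ 0 ∧ aeval (squareVars S) N = n * r ∧
      aeval (squareVars S) D = d * r := by
  set r := ∏ γ ∈ Finset.univ.erase (1 : σ → ℤˣ), scaleVars (signVec S γ) d with hr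
  have hdr : d * r = ∏ γ : σ → ℤˣ, scaleVars (signVec S γ) d := by
    rw [← Finset.mul_prod_erase _ _ (Finset.mem_univ 1), signVec_one, scaleVars_one]
  have hne (γ : σ → ℤˣ) : scaleVars (signVec S γ) d ≠ 0 := by
    intro h0
    apply hd
    rw [← scaleVars_one d, ← signVec_one S, ← inv_mul_cancel γ, signVec_mul,
      ← scaleVars_scaleVars, h0, map_zero]
  have hinv (γ : σ → ℤˣ) : scaleVars (signVec S γ) (d * r) = d * r := by
    rw [hdr, map_prod]
    simp only [scaleVars_scaleVars, ← signVec_mul]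
    exact Fintype.prod_equiv (Equiv.mulLeft γ) _ _ fun _ => rfl
  have hinv' (γ : σ → ℤˣ) : scaleVars (signVec S γ) (n * r) = n * r := by
    have h1 := hinv γ
    rw [map_mul] at h1 ⊢
    refine mul_right_cancel₀ hd ?_
    linear_combination n * h1 - scaleVars (signVec S γ) r * h γ
  obtain ⟨N, hN⟩ := exists_aeval_squareVars_eq S hinv'
  obtain ⟨D, hD⟩ := exists_aeval_squareVars_eq S hinv
  refine ⟨N, D, r, ?_, hN, hD⟩
  rw [hdr]
  exact Finset.prod_ne_zero_iff.2 fun γ _ => hne γ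

end SignChange

section Frames

variable {R S : Type*} [CommRing R] [CommRing S]

/-- The nine invariants of a triple `(u₁, u₂, C)` over a commutative ring. -/
def tripleInvariants (u₁ u₂ : Fin 3 → R) (C : Matrix (Fin 3) (Fin 3) R) : Fin 9 → R :=
  let v₁ := crossProduct u₁ (C *ᵥ u₂)
  let v₂ := crossProduct u₂ (Cᵀ *ᵥ u₁)
  let w₁ := crossProduct u₁ v₁
  let w₂ := crossProduct u₂ v₂
  ![u₁ ⬝ᵥ u₁, u₂ ⬝ᵥ u₂, v₁ ⬝ᵥ v₁, v₂ ⬝ᵥ v₂, u₁ ⬝ᵥ (C *ᵥ u₂),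
    v₁ ⬝ᵥ (C *ᵥ v₂), w₁ ⬝ᵥ (C *ᵥ w₂), v₁ ⬝ᵥ (C *ᵥ w₂), w₁ ⬝ᵥ (C *ᵥ v₂)]

lemma map_crossProduct (φ : R →+* S) (u v : Fin 3 → R) :
    φ ∘ crossProduct u v = crossProduct (φ ∘ u) (φ ∘ v) := by
  ext i
  fin_cases i <;> simp [cross_apply]

lemma map_tripleInvariants (φ : R →+* S) (u₁ u₂ : Fin 3 → R) (C : Matrix (Fin 3) (Fin 3) R) :
    φ ∘ tripleInvariants u₁ u₂ C = tripleInvariants (φ ∘ u₁) (φ ∘ u₂) (C.map φ) := by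
  have hm (M : Matrix (Fin 3) (Fin 3) R) (v : Fin 3 → R) : φ ∘ (M *ᵥ v) = M.map φ *ᵥ (φ ∘ v) :=
    funext fun i => RingHom.map_mulVec φ M v i
  ext i
  fin_cases i <;>
    simp [tripleInvariants, RingHom.map_dotProduct, map_crossProduct, hm, transpose_map]

lemma mulVec_dotProduct_mulVec {g : Matrix (Fin 3) (Fin 3) R} (hg : gᵀ * g = 1)
    (u v : Fin 3 → R) : (g *ᵥ u) ⬝ᵥ (g *ᵥ v) = u ⬝ᵥ v := by
  rw [dotProduct_mulVec, vecMul_mulVec, hg, vecMul_one]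

lemma crossProduct_mulVec {g : Matrix (Fin 3) (Fin 3) R} (hg : gᵀ * g = 1) (hdet : g.det = 1)
    (u v : Fin 3 → R) : crossProduct (g *ᵥ u) (g *ᵥ v) = g *ᵥ crossProduct u v := by
  have h : gᵀ = g.adjugate := by
    calc gᵀ = gᵀ * (g * g.adjugate) := by rw [mul_adjugate, hdet, one_smul, mul_one]
      _ = g.adjugate := by rw [← mul_assoc, hg, one_mul]
  have h' (i j : Fin 3) : g j i = g.adjugate i j := congrFun (congrFun h i) j
  rw [adjugate_fin_three] at h'
  ext i
  have h0 := h' 0 i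
  have h1 := h' 1 i
  have h2 := h' 2 i
  fin_cases i <;> simp at h0 h1 h2 <;>
    simp [mulVec, dotProduct, Fin.sum_univ_three, cross_apply]
  · linear_combination (-(u 1 * v 2 - u 2 * v 1)) * h0 - (u 2 * v 0 - u 0 * v 2) * h1 -
      (u 0 * v 1 - u 1 * v 0) * h2
  · linear_combination (-(u 1 * v 2 - u 2 * v 1)) * h0 - (u 2 * v 0 - u 0 * v 2) * h1 -
      (u 0 * v 1 - u 1 * v 0) * h2
  · linear_combination (-(u 1 * v 2 - u 2 * v 1)) * h0 - (u 2 * v 0 - u 0 * v 2) * h1 -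
      (u 0 * v 1 - u 1 * v 0) * h2

lemma tripleInvariants_smul {g₁ g₂ : Matrix (Fin 3) (Fin 3) ℂ} (h₁ : SO3 g₁) (h₂ : SO3 g₂)
    (u₁ u₂ : Fin 3 → ℂ) (C : Matrix (Fin 3) (Fin 3) ℂ) :
    tripleInvariants (g₁ *ᵥ u₁) (g₂ *ᵥ u₂) (g₁ * C * g₂ᵀ) = tripleInvariants u₁ u₂ C := by
  have hC (v : Fin 3 → ℂ) : (g₁ * C * g₂ᵀ) *ᵥ (g₂ *ᵥ v) = g₁ *ᵥ (C *ᵥ v) := by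
    rw [mulVec_mulVec, mul_assoc, h₂.1, mul_one, mulVec_mulVec]
  have hC' (v : Fin 3 → ℂ) : (g₁ * C * g₂ᵀ)ᵀ *ᵥ (g₁ *ᵥ v) = g₂ *ᵥ (Cᵀ *ᵥ v) := by
    rw [mulVec_mulVec, transpose_mul, transpose_mul, transpose_transpose, mul_assoc, mul_assoc,
      h₁.1, mul_one, mulVec_mulVec]
  simp only [tripleInvariants, hC, hC', crossProduct_mulVec h₁.1 h₁.2,
    crossProduct_mulVec h₂.1 h₂.2, mulVec_dotProduct_mulVec h₁.1, mulVec_dotProduct_mulVec h₂.1]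

/-- The matrix with columns `u`, `v`, `u × v`, normalized by the lengths `a` of `u` and
`c` of `v`. -/
noncomputable def frame (a c : ℂ) (u v : Fin 3 → ℂ) : Matrix (Fin 3) (Fin 3) ℂ :=
  (Matrix.of ![a⁻¹ • u, c⁻¹ • v, (a * c)⁻¹ • crossProduct u v])ᵀ

lemma frame_transpose_mul_mul_frame (a c b d : ℂ) (u v x y : Fin 3 → ℂ)
    (M : Matrix (Fin 3) (Fin 3) ℂ) (i j : Fin 3) :
    ((frame a c u v)ᵀ * M * frame b d x y) i j =
      (![a⁻¹ • u, c⁻¹ • v, (a * c)⁻¹ • crossProduct u v] i) ⬝ᵥ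
        M *ᵥ (![b⁻¹ • x, d⁻¹ • y, (b * d)⁻¹ • crossProduct x y] j) := by
  rw [Matrix.mul_assoc]
  rfl

lemma SO3_frame {a c : ℂ} {u v : Fin 3 → ℂ} (ha : a ≠ 0) (hc : c ≠ 0) (hu : u ⬝ᵥ u = a ^ 2)
    (hv : v ⬝ᵥ v = c ^ 2) (huv : u ⬝ᵥ v = 0) : SO3 (frame a c u v) := by
  have hw : crossProduct u v ⬝ᵥ crossProduct u v = a ^ 2 * c ^ 2 := by
    rw [cross_dot_cross, hu, hv, huv, zero_mul, sub_zero]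
  have hvu : v ⬝ᵥ u = 0 := by rw [dotProduct_comm, huv]
  have hcr : crossProduct u v ⬝ᵥ u = 0 := by rw [dotProduct_comm, dot_self_cross]
  have hcr' : crossProduct u v ⬝ᵥ v = 0 := by rw [dotProduct_comm, dot_cross_self]
  constructor
  · ext i j
    rw [← Matrix.mul_one (frame a c u v)ᵀ, frame_transpose_mul_mul_frame, one_mulVec]
    fin_cases i <;> fin_cases j <;>
      simp [hu, hv, hw, huv, hvu, hcr, hcr', dot_self_cross, dot_cross_self] <;>
      field_simp
  · rw [frame, det_transpose]
    change Matrix.det ![a⁻¹ • u, c⁻¹ • v, (a * c)⁻¹ • crossProduct u v] = 1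
    rw [← triple_product_eq_det, triple_product_permutation, triple_product_permutation]
    simp [hw]
    field_simp

/-- The invariants of the normal form with parameters `t`. -/
def normalInvariants (t : Fin 9 → R) : Fin 9 → R :=
  ![t 0 ^ 2, t 1 ^ 2, t 0 ^ 2 * t 1 ^ 2 * t 2 ^ 2, t 0 ^ 2 * t 1 ^ 2 * t 3 ^ 2,
    t 0 ^ 2 * t 1 ^ 2 * t 4, t 0 ^ 2 * t 1 ^ 2 * t 2 ^ 2 * t 3 ^ 2 * t 5,
    t 0 ^ 4 * t 1 ^ 4 * t 2 ^ 2 * t 3 ^ 2 * t 6, t 0 ^ 2 * t 1 ^ 4 * t 2 ^ 2 * t 3 ^ 2 * t 7,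
    t 0 ^ 4 * t 1 ^ 2 * t 2 ^ 2 * t 3 ^ 2 * t 8]

/-- The matrix of the normal form with parameters `t`; its vectors are `(t 0, 0, 0)` and
`(t 1, 0, 0)`. -/
def normalMatrix (t : Fin 9 → R) : Matrix (Fin 3) (Fin 3) R :=
  !![t 0 * t 1 * t 4, 0, -t 3; 0, t 2 * t 3 * t 5, t 1 * t 2 * t 3 * t 7;
    -t 2, t 0 * t 2 * t 3 * t 8, t 0 * t 1 * t 2 * t 3 * t 6]

lemma tripleInvariants_normalMatrix (t : Fin 9 → R) :
    tripleInvariants ![t 0, 0, 0] ![t 1, 0, 0] (normalMatrix t) = normalInvariants t := by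
  ext i
  fin_cases i <;>
    simp [tripleInvariants, normalInvariants, normalMatrix, cross_apply, mulVec, dotProduct,
      Fin.sum_univ_three] <;> ring

lemma exists_smul_normalMatrix_eq {u₁ u₂ : Fin 3 → ℂ} {C : Matrix (Fin 3) (Fin 3) ℂ}
    {t : Fin 9 → ℂ} (h : tripleInvariants u₁ u₂ C = normalInvariants t) (h0 : t 0 ≠ 0)
    (h1 : t 1 ≠ 0) (h2 : t 2 ≠ 0) (h3 : t 3 ≠ 0) :
    ∃ g₁ g₂, SO3 g₁ ∧ SO3 g₂ ∧ g₁ *ᵥ ![t 0, 0, 0] = u₁ ∧ g₂ *ᵥ ![t 1, 0, 0] = u₂ ∧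
      g₁ * normalMatrix t * g₂ᵀ = C := by
  have e1 : u₁ ⬝ᵥ u₁ = t 0 ^ 2 := congrFun h 0
  have e2 : u₂ ⬝ᵥ u₂ = t 1 ^ 2 := congrFun h 1
  have e3 := congrFun h 2
  have e4 := congrFun h 3
  have e5 := congrFun h 4
  have e6 := congrFun h 5
  have e7 := congrFun h 6
  have e8 := congrFun h 7
  have e9 := congrFun h 8
  simp only [tripleInvariants, normalInvariants, cons_val] at e3 e4 e5 e6 e7 e8 e9
  set v₁ := crossProduct u₁ (C *ᵥ u₂) with hv₁
  set v₂ := crossProduct u₂ (Cᵀ *ᵥ u₁) with hv₂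
  set w₁ := crossProduct u₁ v₁ with hw₁
  set w₂ := crossProduct u₂ v₂ with hw₂
  have hC (x y : Fin 3 → ℂ) : x ⬝ᵥ C *ᵥ y = y ⬝ᵥ Cᵀ *ᵥ x := by
    rw [dotProduct_mulVec, dotProduct_comm, mulVec_transpose]
  have c12 : u₁ ⬝ᵥ C *ᵥ v₂ = 0 := by rw [hC, dotProduct_comm, hv₂, dot_cross_self]
  have c21 : v₁ ⬝ᵥ C *ᵥ u₂ = 0 := by rw [dotProduct_comm, hv₁, dot_cross_self]
  have c13 : u₁ ⬝ᵥ C *ᵥ w₂ = -(t 0 ^ 2 * t 1 ^ 2 * t 3 ^ 2) := by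
    rw [hC, dotProduct_comm, ← e4, hw₂, triple_product_permutation, triple_product_permutation,
      ← cross_anticomm, dotProduct_neg]
  have c31 : w₁ ⬝ᵥ C *ᵥ u₂ = -(t 0 ^ 2 * t 1 ^ 2 * t 2 ^ 2) := by
    rw [dotProduct_comm, ← e3, hw₁, triple_product_permutation, triple_product_permutation,
      ← cross_anticomm, dotProduct_neg]
  have hc : t 0 * t 1 * t 2 ≠ 0 := by simp [h0, h1, h2]
  have hd : t 0 * t 1 * t 3 ≠ 0 := by simp [h0, h1, h3]
  have s1 : SO3 (frame (t 0) (t 0 * t 1 * t 2) u₁ v₁) :=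
    SO3_frame h0 hc e1 (by rw [e3]; ring) (dot_self_cross _ _)
  have s2 : SO3 (frame (t 1) (t 0 * t 1 * t 3) u₂ v₂) :=
    SO3_frame h1 hd e2 (by rw [e4]; ring) (dot_self_cross _ _)
  refine ⟨_, _, s1, s2, ?_, ?_, ?_⟩
  · ext i
    fin_cases i <;> simp [frame, mulVec, dotProduct, Fin.sum_univ_three] <;> field_simp
  · ext i
    fin_cases i <;> simp [frame, mulVec, dotProduct, Fin.sum_univ_three] <;> field_simp
  · have hN : normalMatrix t = (frame (t 0) (t 0 * t 1 * t 2) u₁ v₁)ᵀ * C *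
        frame (t 1) (t 0 * t 1 * t 3) u₂ v₂ := by
      ext i j
      rw [frame_transpose_mul_mul_frame]
      fin_cases i <;> fin_cases j <;>
        simp [normalMatrix, mulVec_smul, ← hw₁, ← hw₂, c12, c21, c13, c31, e5, e6, e7, e8, e9]
      all_goals field_simp
    have o1 := mul_eq_one_comm.1 s1.1
    have o2 := mul_eq_one_comm.1 s2.1
    generalize frame (t 0) (t 0 * t 1 * t 2) u₁ v₁ = E₁ at *
    generalize frame (t 1) (t 0 * t 1 * t 3) u₂ v₂ = E₂ at *
    calc E₁ * normalMatrix t * E₂ᵀ = (E₁ * E₁ᵀ) * C * (E₂ * E₂ᵀ) := by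
          simp only [hN, Matrix.mul_assoc]
      _ = C := by rw [o1, o2, Matrix.one_mul, Matrix.mul_one]

end Frames

section Coordinates

variable {R : Type*}

/-- The vector `u₁` of a point with 15 coordinates. -/
def coordU₁ (x : Fin 15 → R) : Fin 3 → R := ![x 0, x 1, x 2]

/-- The vector `u₂` of a point with 15 coordinates. -/
def coordU₂ (x : Fin 15 → R) : Fin 3 → R := ![x 3, x 4, x 5]

/-- The matrix `C` of a point with 15 coordinates. -/
def coordC (x : Fin 15 → R) : Matrix (Fin 3) (Fin 3) R :=
  !![x 6, x 7, x 8; x 9, x 10, x 11; x 12, x 13, x 14]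

/-- The 15 coordinates of a triple `(u₁, u₂, C)`. -/
def ofTriple (u₁ u₂ : Fin 3 → R) (C : Matrix (Fin 3) (Fin 3) R) : Fin 15 → R :=
  ![u₁ 0, u₁ 1, u₁ 2, u₂ 0, u₂ 1, u₂ 2,
    C 0 0, C 0 1, C 0 2, C 1 0, C 1 1, C 1 2, C 2 0, C 2 1, C 2 2]

lemma coordU₁_ofTriple (u₁ u₂ : Fin 3 → R) (C : Matrix (Fin 3) (Fin 3) R) :
    coordU₁ (ofTriple u₁ u₂ C) = u₁ := by
  ext i; fin_cases i <;> rfl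

lemma coordU₂_ofTriple (u₁ u₂ : Fin 3 → R) (C : Matrix (Fin 3) (Fin 3) R) :
    coordU₂ (ofTriple u₁ u₂ C) = u₂ := by
  ext i; fin_cases i <;> rfl

lemma coordC_ofTriple (u₁ u₂ : Fin 3 → R) (C : Matrix (Fin 3) (Fin 3) R) :
    coordC (ofTriple u₁ u₂ C) = C := by
  ext i j; fin_cases i <;> fin_cases j <;> rfl

lemma ofTriple_coord (x : Fin 15 → R) : ofTriple (coordU₁ x) (coordU₂ x) (coordC x) = x := by
  ext i; fin_cases i <;> rfl

lemma comp_ofTriple {S : Type*} (φ : R → S) (u₁ u₂ : Fin 3 → R) (C : Matrix (Fin 3) (Fin 3) R) :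
    φ ∘ ofTriple u₁ u₂ C = ofTriple (φ ∘ u₁) (φ ∘ u₂) (C.map φ) := by
  ext i; fin_cases i <;> rfl

lemma genAct_eq (g₁ g₂ : Matrix (Fin 3) (Fin 3) ℂ) (x : Fin 15 → ℂ) :
    genAct g₁ g₂ x = ofTriple (g₁ *ᵥ coordU₁ x) (g₂ *ᵥ coordU₂ x) (g₁ * coordC x * g₂ᵀ) := rfl

lemma genAct_genAct (g₁ g₂ h₁ h₂ : Matrix (Fin 3) (Fin 3) ℂ) (x : Fin 15 → ℂ) :
    genAct g₁ g₂ (genAct h₁ h₂ x) = genAct (g₁ * h₁) (g₂ * h₂) x := by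
  simp only [genAct_eq, coordU₁_ofTriple, coordU₂_ofTriple, coordC_ofTriple, mulVec_mulVec,
    transpose_mul, Matrix.mul_assoc]

lemma SO3.mul {g h : Matrix (Fin 3) (Fin 3) ℂ} (hg : SO3 g) (hh : SO3 h) : SO3 (g * h) := by
  refine ⟨?_, by rw [det_mul, hg.2, hh.2, one_mul]⟩
  rw [transpose_mul, Matrix.mul_assoc, ← Matrix.mul_assoc gᵀ, hg.1, Matrix.one_mul, hh.1]

lemma SO3.transpose {g : Matrix (Fin 3) (Fin 3) ℂ} (hg : SO3 g) : SO3 gᵀ :=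
  ⟨by rw [transpose_transpose, mul_eq_one_comm.1 hg.1], by rw [det_transpose, hg.2]⟩

/-- The values of the nine invariants at a point. -/
def invariantsAt [CommRing R] (x : Fin 15 → R) : Fin 9 → R :=
  tripleInvariants (coordU₁ x) (coordU₂ x) (coordC x)

lemma invariantsAt_genAct {g₁ g₂ : Matrix (Fin 3) (Fin 3) ℂ} (h₁ : SO3 g₁) (h₂ : SO3 g₂)
    (x : Fin 15 → ℂ) : invariantsAt (genAct g₁ g₂ x) = invariantsAt x := by
  rw [invariantsAt, genAct_eq, coordU₁_ofTriple, coordU₂_ofTriple, coordC_ofTriple,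
    tripleInvariants_smul h₁ h₂, invariantsAt]

lemma eval_genFpoly (x : Fin 15 → ℂ) : (fun i => eval x (genFpoly i)) = invariantsAt x := by
  have h : (fun i => eval x (genFpoly i)) = eval x ∘ tripleInvariants genU₁ genU₂ genC := rfl
  have h₁ : eval x ∘ genU₁ = coordU₁ x := by
    ext i; fin_cases i <;> simp [genU₁, coordU₁]
  have h₂ : eval x ∘ genU₂ = coordU₂ x := by
    ext i; fin_cases i <;> simp [genU₂, coordU₂]
  have h₃ : genC.map (eval x) = coordC x := by
    ext i j; fin_cases i <;> fin_cases j <;> simp [genC, coordC]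
  rw [h, map_tripleInvariants, h₁, h₂, h₃, invariantsAt]

lemma eval_aeval_apply {σ τ : Type*} (t : τ → ℂ) (φ : σ → MvPolynomial τ ℂ)
    (p : MvPolynomial σ ℂ) : eval t (aeval φ p) = eval (fun i => eval t (φ i)) p := by
  induction p using MvPolynomial.induction_on with
  | C a => simp
  | add p q hp hq => simp only [map_add, hp, hq]
  | mul_X p i hp => simp only [map_mul, hp, aeval_X, eval_X]

lemma eval_aeval_genFpoly (x : Fin 15 → ℂ) (P : MvPolynomial (Fin 9) ℂ) :
    eval x (aeval genFpoly P) = eval (invariantsAt x) P := by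
  rw [eval_aeval_apply, eval_genFpoly]

lemma exists_eval_eq_eval_genAct (g₁ g₂ : Matrix (Fin 3) (Fin 3) ℂ)
    (p : MvPolynomial (Fin 15) ℂ) :
    ∃ p' : MvPolynomial (Fin 15) ℂ, ∀ x, eval x p' = eval (genAct g₁ g₂ x) p := by
  refine ⟨aeval (ofTriple (g₁.map C *ᵥ coordU₁ X) (g₂.map C *ᵥ coordU₂ X)
    (g₁.map C * coordC X * (g₂.map C)ᵀ)) p, fun x => ?_⟩
  have hC (g : Matrix (Fin 3) (Fin 3) ℂ) : (g.map C).map (eval x) = g := by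
    ext i j; simp
  have hm (g : Matrix (Fin 3) (Fin 3) ℂ) (v : Fin 3 → MvPolynomial (Fin 15) ℂ) :
      eval x ∘ (g.map C *ᵥ v) = g *ᵥ (eval x ∘ v) := by
    ext i
    rw [Function.comp_apply, RingHom.map_mulVec, hC]
  have h₁ : eval x ∘ coordU₁ X = coordU₁ x := by
    ext i; fin_cases i <;> simp [coordU₁]
  have h₂ : eval x ∘ coordU₂ X = coordU₂ x := by
    ext i; fin_cases i <;> simp [coordU₂]
  have h₃ : (coordC X).map (eval x) = coordC x := by
    ext i j; fin_cases i <;> fin_cases j <;> simp [coordC]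
  rw [eval_aeval_apply, genAct_eq]
  change eval (eval x ∘ ofTriple _ _ _) p = _
  rw [comp_ofTriple, hm, hm, Matrix.map_mul, Matrix.map_mul, ← transpose_map, hC, hC, h₁, h₂, h₃]

end Coordinates

section NormalForm

/-- The point with vectors `(t 0, 0, 0)`, `(t 1, 0, 0)` and matrix `normalMatrix t`. -/
def normalPoint {R : Type*} [CommRing R] (t : Fin 9 → R) : Fin 15 → R :=
  ofTriple ![t 0, 0, 0] ![t 1, 0, 0] (normalMatrix t)

lemma exists_eval_eq_eval_normalPoint (p : MvPolynomial (Fin 15) ℂ) :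
    ∃ p' : MvPolynomial (Fin 9) ℂ, ∀ t, eval t p' = eval (normalPoint t) p := by
  refine ⟨aeval (normalPoint X) p, fun t => ?_⟩
  rw [eval_aeval_apply]
  congr 2
  ext i
  fin_cases i <;> simp [normalPoint, ofTriple, normalMatrix]

lemma invariantsAt_normalPoint (t : Fin 9 → ℂ) :
    invariantsAt (normalPoint t) = normalInvariants t := by
  rw [invariantsAt, normalPoint, coordU₁_ofTriple, coordU₂_ofTriple, coordC_ofTriple,
    tripleInvariants_normalMatrix]

/-- The product of the first four variables. -/
noncomputable def leadProd : MvPolynomial (Fin 9) ℂ := X 0 * X 1 * X 2 * X 3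

lemma leadProd_ne_zero : leadProd ≠ 0 := by
  simp [leadProd]

lemma eval_leadProd_ne_zero {t : Fin 9 → ℂ} :
    eval t leadProd ≠ 0 ↔ t 0 ≠ 0 ∧ t 1 ≠ 0 ∧ t 2 ≠ 0 ∧ t 3 ≠ 0 := by
  simp [leadProd, and_assoc]

lemma eval_normalInvariants_leadProd_ne_zero {t : Fin 9 → ℂ} (ht : eval t leadProd ≠ 0) :
    eval (normalInvariants t) leadProd ≠ 0 := by
  rw [eval_leadProd_ne_zero] at ht ⊢
  simp [normalInvariants, ht]

lemma exists_normalInvariants_eq {φ : Fin 9 → ℂ} (hφ : eval φ leadProd ≠ 0) :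
    ∃ t, normalInvariants t = φ ∧ eval t leadProd ≠ 0 := by
  rw [eval_leadProd_ne_zero] at hφ
  obtain ⟨h0, h1, h2, h3⟩ := hφ
  obtain ⟨a, ha⟩ := IsAlgClosed.exists_pow_nat_eq (φ 0) two_pos
  obtain ⟨b, hb⟩ := IsAlgClosed.exists_pow_nat_eq (φ 1) two_pos
  obtain ⟨c, hc⟩ := IsAlgClosed.exists_pow_nat_eq (φ 2 / (φ 0 * φ 1)) two_pos
  obtain ⟨d, hd⟩ := IsAlgClosed.exists_pow_nat_eq (φ 3 / (φ 0 * φ 1)) two_pos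
  have ha4 : a ^ 4 = φ 0 ^ 2 := by rw [← ha]; ring
  have hb4 : b ^ 4 = φ 1 ^ 2 := by rw [← hb]; ring
  refine ⟨![a, b, c, d, φ 4 / (φ 0 * φ 1), φ 5 * φ 0 * φ 1 / (φ 2 * φ 3), φ 6 / (φ 2 * φ 3),
    φ 7 * φ 0 / (φ 2 * φ 3), φ 8 * φ 1 / (φ 2 * φ 3)], ?_, ?_⟩
  · ext i
    fin_cases i <;> simp [normalInvariants, ha, hb, hc, hd, ha4, hb4] <;> field_simp
  · rw [eval_leadProd_ne_zero]
    refine ⟨?_, ?_, ?_, ?_⟩ <;> refine ne_zero_pow two_ne_zero ?_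
    · simpa [ha]
    · simpa [hb]
    · simp [hc, h0, h1, h2]
    · simp [hd, h0, h1, h3]

lemma exists_genAct_normalPoint_eq {x : Fin 15 → ℂ} {t : Fin 9 → ℂ}
    (h : invariantsAt x = normalInvariants t) (ht : eval t leadProd ≠ 0) :
    ∃ g₁ g₂, SO3 g₁ ∧ SO3 g₂ ∧ genAct g₁ g₂ (normalPoint t) = x := by
  obtain ⟨h0, h1, h2, h3⟩ := eval_leadProd_ne_zero.1 ht
  obtain ⟨g₁, g₂, hg₁, hg₂, e₁, e₂, e₃⟩ := exists_smul_normalMatrix_eq h h0 h1 h2 h3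
  refine ⟨g₁, g₂, hg₁, hg₂, ?_⟩
  rw [genAct_eq, normalPoint, coordU₁_ofTriple, coordU₂_ofTriple, coordC_ofTriple, e₁, e₂, e₃,
    ofTriple_coord]

/-- Generic points with equal invariants lie in the same orbit. -/
lemma exists_genAct_eq {x y : Fin 15 → ℂ} (h : invariantsAt x = invariantsAt y)
    (hx : eval (invariantsAt x) leadProd ≠ 0) :
    ∃ g₁ g₂, SO3 g₁ ∧ SO3 g₂ ∧ genAct g₁ g₂ x = y := by
  obtain ⟨t, ht, ht0⟩ := exists_normalInvariants_eq hx
  obtain ⟨g₁, g₂, hg₁, hg₂, rfl⟩ := exists_genAct_normalPoint_eq ht.symm ht0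
  obtain ⟨k₁, k₂, hk₁, hk₂, rfl⟩ := exists_genAct_normalPoint_eq (ht.trans h).symm ht0
  refine ⟨k₁ * g₁ᵀ, k₂ * g₂ᵀ, hk₁.mul hg₁.transpose, hk₂.mul hg₂.transpose, ?_⟩
  rw [genAct_genAct, Matrix.mul_assoc, Matrix.mul_assoc, hg₁.1, hg₂.1, Matrix.mul_one,
    Matrix.mul_one]

/-- The parameters of the normal form that the invariants determine up to sign. -/
def signedParams : Finset (Fin 9) := {0, 1, 2, 3}

lemma normalInvariants_signVec_mul (γ : Fin 9 → ℤˣ) (t : Fin 9 → ℂ) :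
    normalInvariants (signVec signedParams γ * t) = normalInvariants t := by
  have h (i : Fin 9) : ((γ i : ℤ) : ℂ) ^ 2 = 1 := by
    rcases Int.units_eq_one_or (γ i) with h | h <;> simp [h]
  have h' (i : Fin 9) : ((γ i : ℤ) : ℂ) ^ 4 = 1 := by
    rw [show 4 = 2 * 2 from rfl, pow_mul, h, one_pow]
  ext i
  fin_cases i <;> simp [normalInvariants, signVec, signedParams, mul_pow, h, h']

/-- A polynomial in the squared parameters is, up to a power of the product of the first four
invariants, a polynomial in the invariants. -/
lemma exists_eval_normalInvariants (N : MvPolynomial (Fin 9) ℂ) :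
    ∃ (P : MvPolynomial (Fin 9) ℂ) (M : ℕ), ∀ t, eval (normalInvariants t) P =
      eval (normalInvariants t) leadProd ^ M * eval t (aeval (squareVars signedParams) N) := by
  induction N using MvPolynomial.induction_on with
  | C a => exact ⟨C a, 0, fun t => by simp⟩
  | add p q hp hq =>
    obtain ⟨P, M, hP⟩ := hp
    obtain ⟨Q, L, hQ⟩ := hq
    refine ⟨P * leadProd ^ L + Q * leadProd ^ M, M + L, fun t => ?_⟩
    simp only [map_add, map_mul, map_pow, hP, hQ]
    ring
  | mul_X p i hp =>
    obtain ⟨P, M, hP⟩ := hp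
    let num : Fin 9 → MvPolynomial (Fin 9) ℂ :=
      ![X 0 * leadProd, X 1 * leadProd, X 2 * (X 2 * X 3), X 3 * (X 2 * X 3), X 4 * (X 2 * X 3),
        X 5 * (X 0 * X 1) ^ 2, X 6 * (X 0 * X 1), X 7 * (X 0 ^ 2 * X 1), X 8 * (X 0 * X 1 ^ 2)]
    refine ⟨P * num i, M + 1, fun t => ?_⟩
    have h : eval (normalInvariants t) (num i) =
        eval (normalInvariants t) leadProd * eval t (squareVars signedParams i) := by
      fin_cases i <;> simp [num, leadProd, normalInvariants, squareVars, signedParams] <;> ring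
    simp only [map_mul, hP, h, aeval_X]
    ring

lemma aeval_genFpoly_ne_zero {Q : MvPolynomial (Fin 9) ℂ} (hQ : Q ≠ 0) :
    aeval genFpoly Q ≠ 0 := by
  obtain ⟨φ, hφ⟩ : ∃ φ, eval φ (Q * leadProd) ≠ 0 := by
    by_contra! h
    exact mul_ne_zero hQ leadProd_ne_zero (MvPolynomial.funext fun φ => by simp [h φ])
  rw [map_mul, mul_ne_zero_iff] at hφ
  obtain ⟨t, rfl, -⟩ := exists_normalInvariants_eq hφ.2
  intro h
  apply hφ.1
  rw [← invariantsAt_normalPoint, ← eval_aeval_genFpoly, h, map_zero]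

end NormalForm

lemma exists_eval_ne_zero {σ : Type*} {p : MvPolynomial σ ℂ} (hp : p ≠ 0) :
    ∃ x, eval x p ≠ 0 := by
  by_contra! h
  exact hp (MvPolynomial.funext fun x => by simp [h x])

lemma invariant_of_mul_aeval_genFpoly_eq {p q : MvPolynomial (Fin 15) ℂ}
    {P Q : MvPolynomial (Fin 9) ℂ} (hQ : aeval genFpoly Q ≠ 0)
    (h : p * aeval genFpoly Q = aeval genFpoly P * q) {g₁ g₂ : Matrix (Fin 3) (Fin 3) ℂ}
    (h₁ : SO3 g₁) (h₂ : SO3 g₂) (x : Fin 15 → ℂ) :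
    eval (genAct g₁ g₂ x) p * eval x q = eval x p * eval (genAct g₁ g₂ x) q := by
  obtain ⟨p', hp'⟩ := exists_eval_eq_eval_genAct g₁ g₂ p
  obtain ⟨q', hq'⟩ := exists_eval_eq_eval_genAct g₁ g₂ q
  suffices H : p' * q = p * q' by
    simpa [hp', hq'] using congrArg (eval x) H
  refine mul_right_cancel₀ hQ (MvPolynomial.funext fun y => ?_)
  have e := congrArg (eval y) h
  have e' := congrArg (eval (genAct g₁ g₂ y)) h
  simp only [map_mul, eval_aeval_genFpoly, invariantsAt_genAct h₁ h₂] at e e'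
  simp only [map_mul, eval_aeval_genFpoly, hp', hq']
  linear_combination eval y q * e' - eval (genAct g₁ g₂ y) q * e

lemma exists_mul_aeval_genFpoly_eq {p q : MvPolynomial (Fin 15) ℂ} (hq : q ≠ 0)
    (h : ∀ g₁ g₂ : Matrix (Fin 3) (Fin 3) ℂ, SO3 g₁ → SO3 g₂ → ∀ x : Fin 15 → ℂ,
      eval (genAct g₁ g₂ x) p * eval x q = eval x p * eval (genAct g₁ g₂ x) q) :
    ∃ P Q : MvPolynomial (Fin 9) ℂ, aeval genFpoly Q ≠ 0 ∧
      p * aeval genFpoly Q = aeval genFpoly P * q := by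
  have hxy {x y : Fin 15 → ℂ} (hxy : invariantsAt x = invariantsAt y)
      (hx : eval (invariantsAt x) leadProd ≠ 0) : eval y p * eval x q = eval x p * eval y q := by
    obtain ⟨g₁, g₂, hg₁, hg₂, rfl⟩ := exists_genAct_eq hxy hx
    exact h g₁ g₂ hg₁ hg₂ x
  have hlead := aeval_genFpoly_ne_zero leadProd_ne_zero
  obtain ⟨x₀, hx₀⟩ := exists_eval_ne_zero (mul_ne_zero hq hlead)
  rw [map_mul, mul_ne_zero_iff, eval_aeval_genFpoly] at hx₀
  obtain ⟨t₀, ht₀, ht₀'⟩ := exists_normalInvariants_eq hx₀.2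
  obtain ⟨k₁, k₂, hk₁, hk₂, rfl⟩ := exists_genAct_normalPoint_eq ht₀.symm ht₀'
  have hpull (p : MvPolynomial (Fin 15) ℂ) : ∃ p' : MvPolynomial (Fin 9) ℂ,
      ∀ t, eval t p' = eval (genAct k₁ k₂ (normalPoint t)) p := by
    obtain ⟨p₁, hp₁⟩ := exists_eval_eq_eval_genAct k₁ k₂ p
    obtain ⟨p₂, hp₂⟩ := exists_eval_eq_eval_normalPoint p₁
    exact ⟨p₂, fun t => by rw [hp₂, hp₁]⟩
  obtain ⟨n, hn⟩ := hpull p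
  obtain ⟨d, hd⟩ := hpull q
  have hinv (t : Fin 9 → ℂ) :
      invariantsAt (genAct k₁ k₂ (normalPoint t)) = normalInvariants t := by
    rw [invariantsAt_genAct hk₁ hk₂, invariantsAt_normalPoint]
  have hd0 : d ≠ 0 := by
    rintro rfl
    exact hx₀.1 (by rw [← hd, map_zero])
  obtain ⟨N, D, r, hdr, hN, hD⟩ := exists_squareVars_fraction signedParams (n := n) hd0 fun γ => by
    refine mul_right_cancel₀ leadProd_ne_zero (MvPolynomial.funext fun t => ?_)
    simp only [map_mul, eval_scaleVars, hn, hd]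
    by_cases ht : eval t leadProd = 0
    · rw [ht, mul_zero, mul_zero]
    · rw [← hxy (by rw [hinv, hinv, normalInvariants_signVec_mul])
        (by rw [hinv]; exact eval_normalInvariants_leadProd_ne_zero ht)]
  obtain ⟨P, M, hP⟩ := exists_eval_normalInvariants N
  obtain ⟨Q, L, hQ⟩ := exists_eval_normalInvariants D
  refine ⟨P * leadProd ^ L, Q * leadProd ^ M, aeval_genFpoly_ne_zero ?_, ?_⟩
  · refine mul_ne_zero ?_ (pow_ne_zero _ leadProd_ne_zero)
    rintro rfl
    obtain ⟨t, ht⟩ := exists_eval_ne_zero (mul_ne_zero hdr leadProd_ne_zero)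
    rw [map_mul, mul_ne_zero_iff] at ht
    have := hQ t
    rw [map_zero, hD, eq_comm] at this
    exact mul_ne_zero (pow_ne_zero _ (eval_normalInvariants_leadProd_ne_zero ht.2)) ht.1 this
  · refine mul_right_cancel₀ hlead (MvPolynomial.funext fun x => ?_)
    simp only [map_mul, map_pow, eval_aeval_genFpoly]
    by_cases hx : eval (invariantsAt x) leadProd = 0
    · rw [hx, mul_zero, mul_zero]
    obtain ⟨t, ht, -⟩ := exists_normalInvariants_eq hx
    have e := hxy (x := x) (y := genAct k₁ k₂ (normalPoint t)) (by rw [hinv, ht]) hx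
    rw [← ht, hP, hQ, hN, hD, map_mul, map_mul, hn, hd]
    linear_combination (-eval (normalInvariants t) leadProd ^ (M + L + 1) * eval t r) * e

/-- The nine invariants `f₁, …, f₉` are algebraically independent over ℂ, and the fixed
field of the SO₃(ℂ)×SO₃(ℂ)-action on the field of rational functions in the 15
coordinates of `(u₁, u₂, C)` equals `ℂ(f₁, …, f₉)`: a rational function `p/q` is
invariant iff it is a rational function of `f₁, …, f₉`. -/
theorem invariant_field_eq_C_f₁_to_f₉ :
    AlgebraicIndependent ℂ genFpoly ∧
      ∀ p q : MvPolynomial (Fin 15) ℂ, q ≠ 0 →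
        ((∀ g₁ g₂ : Matrix (Fin 3) (Fin 3) ℂ, SO3 g₁ → SO3 g₂ → ∀ x : Fin 15 → ℂ,
            eval (genAct g₁ g₂ x) p * eval x q = eval x p * eval (genAct g₁ g₂ x) q) ↔
          ∃ P Q : MvPolynomial (Fin 9) ℂ, aeval genFpoly Q ≠ 0 ∧
            p * aeval genFpoly Q = aeval genFpoly P * q) := by
  refine ⟨?_, fun p q hq => ⟨exists_mul_aeval_genFpoly_eq hq, ?_⟩⟩
  · rw [algebraicIndependent_iff]
    intro Q hQ
    by_contra h
    exact aeval_genFpoly_ne_zero h hQ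
  · rintro ⟨P, Q, hQ, h⟩ g₁ g₂ h₁ h₂ x
    exact invariant_of_mul_aeval_genFpoly_eq hQ h h₁ h₂ x
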